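/- Let T be the N×N Hermitian Toeplitz matrix determined by t₀ ∈ ℝ and t₁,…,t_{N−1} ∈ ℂ, let c = (t₀, t₁, …, t_{N−1}, 0, t_{N−1}*, …, t₁*)ᵀ ∈ ℂ^{2N}, and let μ = F·c where F is the 2N×2N DFT matrix. Then every entry of μ is real, and the smallest eigenvalue of T satisfies λ_min(T) ≥ (1/2)·( min_{0≤i≤N−1} Re(μ_{2i}) + min_{0≤i≤N−1} Re(μ_{2i+1}) ), i.e., one half of the sum of the minimum over the even-indexed entries of μ and the minimum over the odd-indexed entries of μ. -/

import Mathlib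

open Matrix

lemma aux_geom {M : ℕ} {ζ : ℂ} (hM : 0 < M) (h : IsPrimitiveRoot ζ M) (j : ℤ) :
    ∑ k ∈ Finset.range M, ζ ^ ((k : ℤ) * j) = if (M : ℤ) ∣ j then (M : ℂ) else 0 := by
  have e : ∀ k : ℕ, ζ ^ ((k : ℤ) * j) = (ζ ^ j) ^ k := by
    intro k
    rw [mul_comm, _root_.zpow_mul, zpow_natCast]
  simp only [e]
  split_ifs with hd
  · rw [(h.zpow_eq_one_iff_dvd j).2 hd]; simp
  · have h1 : ζ ^ j ≠ 1 := fun hh => hd ((h.zpow_eq_one_iff_dvd j).1 hh)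
    rw [geom_sum_eq h1, ← zpow_natCast, ← _root_.zpow_mul, mul_comm j, _root_.zpow_mul, zpow_natCast,
      h.pow_eq_one]
    simp

/-- The transform of `v` at frequency `k`. -/
noncomputable def auxX {N : ℕ} (ω : ℂ) (v : Fin N → ℂ) (k : ℤ) : ℂ :=
  ∑ n : Fin N, v n * ω ^ (-(k * (n.1 : ℤ)))

lemma aux_star (ω : ℂ) (hω : star ω = ω⁻¹) (k : ℤ) : star (ω ^ k) = ω ^ (-k) := by
  rw [star_zpow₀, hω, _root_.inv_zpow, _root_.zpow_neg]

lemma aux_normSq {N : ℕ} (ω : ℂ) (h0 : ω ≠ 0) (hω : star ω = ω⁻¹) (v : Fin N → ℂ) (k : ℤ) :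
    ((Complex.normSq (auxX ω v k) : ℝ) : ℂ) =
      ∑ m : Fin N, ∑ n : Fin N, star (v m) * v n * ω ^ (k * ((m.1 : ℤ) - n.1)) := by
  rw [Complex.normSq_eq_conj_mul_self]
  change star (auxX ω v k) * _ = _
  unfold auxX
  rw [star_sum, Finset.sum_mul_sum]
  refine Finset.sum_congr rfl fun m _ => Finset.sum_congr rfl fun n _ => ?_
  rw [star_mul', aux_star ω hω]
  have : ω ^ (k * ((m.1 : ℤ) - n.1)) = ω ^ (-(-(k * (m.1:ℤ)))) * ω ^ (-(k * (n.1:ℤ))) := by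
    rw [← zpow_add₀ h0]; congr 1; ring
  rw [this]; ring

lemma aux_parseval {N : ℕ} (hN : 0 < N) (ω : ℂ) (h : IsPrimitiveRoot ω (2 * N))
    (hω : star ω = ω⁻¹) (v : Fin N → ℂ) (s : ℤ) :
    ∑ i ∈ Finset.range N, Complex.normSq (auxX ω v (2 * i + s)) =
      N * ∑ n, Complex.normSq (v n) := by
  have h0 : ω ≠ 0 := h.ne_zero (by omega)
  have h2 : IsPrimitiveRoot (ω ^ 2) N := h.pow (by omega) rfl
  have key : ((∑ i ∈ Finset.range N, Complex.normSq (auxX ω v (2 * i + s)) : ℝ) : ℂ) =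
      ((N * ∑ n, Complex.normSq (v n) : ℝ) : ℂ) := by
    push_cast
    simp only [aux_normSq ω h0 hω]
    rw [Finset.sum_comm, Finset.mul_sum]
    refine Finset.sum_congr rfl fun m _ => ?_
    rw [Finset.sum_comm]
    have e : ∀ n : Fin N, ∑ i ∈ Finset.range N,
        star (v m) * v n * ω ^ ((2 * (i : ℤ) + s) * ((m.1 : ℤ) - n.1)) =
        if n = m then (N : ℂ) * Complex.normSq (v m) else 0 := by
      intro n
      have e1 : ∀ i : ℕ, star (v m) * v n * ω ^ ((2 * (i : ℤ) + s) * ((m.1 : ℤ) - n.1)) =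
          star (v m) * v n * ω ^ (s * ((m.1 : ℤ) - n.1)) *
            (ω ^ 2) ^ ((i : ℤ) * ((m.1 : ℤ) - n.1)) := by
        intro i
        have : (ω ^ 2) ^ ((i : ℤ) * ((m.1 : ℤ) - n.1)) =
            ω ^ (2 * ((i : ℤ) * ((m.1 : ℤ) - n.1))) := by
          rw [_root_.zpow_mul ω 2]; norm_cast
        rw [this, mul_assoc _ (ω ^ _) (ω ^ _), ← zpow_add₀ h0]
        congr 2; ring
      simp only [e1]
      rw [← Finset.mul_sum, aux_geom hN h2]
      by_cases hnm : n = m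
      · subst hnm
        simp [Complex.normSq_eq_conj_mul_self]
        ring
      · rw [if_neg hnm, if_neg, mul_zero]
        intro hd
        apply hnm
        have := Int.eq_zero_of_abs_lt_dvd hd (by rw [abs_lt]; constructor <;> omega)
        apply Fin.ext; omega
    simp only [e]
    simp
  exact_mod_cast key

/-- DFT of a sequence. -/
noncomputable def auxMu (N : ℕ) (ω : ℂ) (c : ℕ → ℂ) (k : ℕ) : ℂ :=
  ∑ l ∈ Finset.range (2 * N), ω ^ (-((k : ℤ) * (l : ℤ))) * c l

lemma aux_inv {N : ℕ} (hN : 0 < N) (ω : ℂ) (h : IsPrimitiveRoot ω (2 * N)) (c : ℕ → ℂ)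
    (d : ℤ) (l₀ : ℕ) (hl : l₀ < 2 * N) (hd : ((2 * N : ℕ) : ℤ) ∣ d - l₀) :
    ∑ k ∈ Finset.range (2 * N), auxMu N ω c k * ω ^ ((k : ℤ) * d) = (2 * N : ℕ) * c l₀ := by
  have h0 : ω ≠ 0 := h.ne_zero (by omega)
  unfold auxMu
  simp only [Finset.sum_mul]
  rw [Finset.sum_comm, Finset.sum_eq_single l₀]
  · have e : ∀ k : ℕ, ω ^ (-((k : ℤ) * (l₀ : ℤ))) * c l₀ * ω ^ ((k : ℤ) * d) =
        ω ^ ((k : ℤ) * (d - l₀)) * c l₀ := by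
      intro k
      rw [mul_right_comm, ← zpow_add₀ h0]; congr 2; ring
    simp only [e]
    rw [← Finset.sum_mul, aux_geom (by omega) h, if_pos hd]
  · intro l hlr hne
    have e : ∀ k : ℕ, ω ^ (-((k : ℤ) * (l : ℤ))) * c l * ω ^ ((k : ℤ) * d) =
        ω ^ ((k : ℤ) * (d - l)) * c l := by
      intro k
      rw [mul_right_comm, ← zpow_add₀ h0]; congr 2; ring
    simp only [e]
    rw [← Finset.sum_mul, aux_geom (by omega) h, if_neg, zero_mul]
    intro hd'
    have h3 := dvd_sub hd' hd
    rw [Finset.mem_range] at hlr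
    have := Int.eq_zero_of_abs_lt_dvd h3 (by rw [abs_lt]; constructor <;> omega)
    omega
  · intro hh; exact absurd (Finset.mem_range.2 hl) hh

lemma aux_real {N : ℕ} (hN : 0 < N) (ω : ℂ) (h : IsPrimitiveRoot ω (2 * N))
    (hω : star ω = ω⁻¹) (c : ℕ → ℂ) (hc0 : star (c 0) = c 0)
    (hc : ∀ l, l < 2 * N → 0 < l → star (c l) = c (2 * N - l)) (k : ℕ) :
    (auxMu N ω c k).im = 0 := by
  have h0 : ω ≠ 0 := h.ne_zero (by omega)
  rw [← Complex.conj_eq_iff_im]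
  change star _ = _
  unfold auxMu
  obtain ⟨M, hM⟩ : ∃ M, 2 * N = M + 1 := ⟨2 * N - 1, by omega⟩
  rw [star_sum, hM, Finset.sum_range_succ', Finset.sum_range_succ' (fun l => _ * _)]
  congr 1
  · rw [← Finset.sum_range_reflect]
    refine Finset.sum_congr rfl fun l hl => ?_
    rw [Finset.mem_range] at hl
    rw [star_mul', aux_star ω hω, hc _ (by omega) (by omega)]
    have e1 : 2 * N - (M - 1 - l + 1) = l + 1 := by omega
    rw [e1]
    congr 1
    have e2 : -(-((k : ℤ) * ((M - 1 - l + 1 : ℕ) : ℤ))) =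
        ((2 * N : ℕ) : ℤ) * k + -((k : ℤ) * ((l + 1 : ℕ) : ℤ)) := by
      have : ((M - 1 - l + 1 : ℕ) : ℤ) = ((2 * N : ℕ) : ℤ) - ((l + 1 : ℕ) : ℤ) := by omega
      rw [this]; ring
    rw [e2, zpow_add₀ h0, _root_.zpow_mul, zpow_natCast ω, h.pow_eq_one, _root_.one_zpow, one_mul]
  · simp only [star_mul', hc0]; simp

lemma aux_split (f : ℕ → ℝ) (N : ℕ) : ∑ k ∈ Finset.range (2 * N), f k =
    ∑ i ∈ Finset.range N, f (2 * i) + ∑ i ∈ Finset.range N, f (2 * i + 1) := by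
  induction N with
  | zero => simp
  | succ n ih =>
    rw [show 2 * (n + 1) = 2 * n + 1 + 1 by ring, Finset.sum_range_succ, Finset.sum_range_succ, ih,
      Finset.sum_range_succ, Finset.sum_range_succ]
    ring

/-- Lemma 3 (lower bound): for a Hermitian Toeplitz matrix `T`, the entries of `μ = F c`
are real and every eigenvalue of `T` is at least
`(1/2)(min over even-indexed entries of μ + min over odd-indexed entries of μ)`. -/
theorem stmt4 (N : ℕ) (hN : 0 < N) (t : ℕ → ℂ) (ht0 : (t 0).im = 0)
    (T : Matrix (Fin N) (Fin N) ℂ)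
    (hT : ∀ m n : Fin N, T m n =
      if (n : ℕ) ≤ (m : ℕ) then t (m.1 - n.1) else star (t (n.1 - m.1)))
    (hHerm : T.IsHermitian)
    (c : Fin (2 * N) → ℂ)
    (hc : ∀ i : Fin (2 * N), c i =
      if (i : ℕ) < N then t i.1 else if (i : ℕ) = N then 0 else star (t (2 * N - i.1)))
    (F : Matrix (Fin (2 * N)) (Fin (2 * N)) ℂ)
    (hF : ∀ m n : Fin (2 * N), F m n =
      Complex.exp (((-(2 * Real.pi * (m.1 : ℝ) * (n.1 : ℝ) / (2 * N)) : ℝ) : ℂ) * Complex.I))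
    (μ : Fin (2 * N) → ℂ) (hμ : μ = F *ᵥ c) :
    (∀ i, (μ i).im = 0) ∧
    ∀ j : Fin N,
      (1 / 2) * ((⨅ i : Fin N, (μ ⟨2 * i.1, by have := i.isLt; omega⟩).re) +
        (⨅ i : Fin N, (μ ⟨2 * i.1 + 1, by have := i.isLt; omega⟩).re)) ≤
      hHerm.eigenvalues j := by
  obtain ⟨ω, hωd⟩ : ∃ ω : ℂ, ω = Complex.exp (2 * Real.pi * Complex.I / ((2 * N : ℕ) : ℂ)) :=
    ⟨_, rfl⟩
  have hprim : IsPrimitiveRoot ω (2 * N) := by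
    rw [hωd]; exact Complex.isPrimitiveRoot_exp _ (by omega)
  have h0 : ω ≠ 0 := hprim.ne_zero (by omega)
  have hω : star ω = ω⁻¹ := by
    rw [hωd, ← Complex.exp_neg]
    change (starRingEnd ℂ) _ = _
    rw [← Complex.exp_conj]
    congr 1
    have h2 : (starRingEnd ℂ) (2 : ℂ) = 2 := Complex.conj_ofNat 2
    simp [h2]
    ring
  obtain ⟨c', hc'⟩ : ∃ c' : ℕ → ℂ, ∀ i, c' i =
      if i < N then t i else if i = N then 0 else star (t (2 * N - i)) := ⟨_, fun _ => rfl⟩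
  have hμ' : ∀ k : Fin (2 * N), μ k = auxMu N ω c' k.1 := by
    intro k
    rw [hμ, auxMu, Finset.sum_range]
    simp only [mulVec, dotProduct]
    refine Finset.sum_congr rfl fun l _ => ?_
    rw [hc, hc', hF]
    congr 1
    rw [hωd, ← Complex.exp_int_mul]
    congr 1
    push_cast
    ring
  have hreal : ∀ k, (auxMu N ω c' k).im = 0 := by
    refine aux_real hN ω hprim hω c' ?_ ?_
    · rw [hc', if_pos hN]; exact Complex.conj_eq_iff_im.2 ht0
    · intro l hl hl0
      rw [hc', hc']
      rcases lt_trichotomy l N with h | h | h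
      · rw [if_pos h, if_neg (by omega), if_neg (by omega)]
        congr 2; omega
      · subst h
        rw [if_neg (by omega), if_pos rfl, if_neg (by omega), if_pos (by omega)]; simp
      · rw [if_neg (by omega), if_neg (by omega), if_pos (by omega), star_star]
  refine ⟨fun i => by rw [hμ']; exact hreal _, fun j => ?_⟩
  have hTe : ∀ m n : Fin N, ((2 * N : ℕ) : ℂ) * T m n =
      ∑ k ∈ Finset.range (2 * N), auxMu N ω c' k * ω ^ ((k : ℤ) * ((m.1 : ℤ) - n.1)) := by
    intro m n
    have := m.2
    have := n.2
    rw [hT]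
    split_ifs with h
    · rw [aux_inv hN ω hprim c' _ (m.1 - n.1) (by omega)
        (by rw [show ((m.1 : ℤ) - n.1) - ((m.1 - n.1 : ℕ) : ℤ) = 0 by omega]; exact dvd_zero _)]
      rw [hc', if_pos (by omega)]
    · rw [aux_inv hN ω hprim c' _ (2 * N + m.1 - n.1) (by omega)
        ⟨-1, by omega⟩]
      rw [hc', if_neg (by omega), if_neg (by omega)]
      congr 3; omega
  obtain ⟨v, hv⟩ : ∃ v : Fin N → ℂ, v = (hHerm.eigenvectorBasis j).ofLp := ⟨_, rfl⟩
  have hnorm : ∑ n, Complex.normSq (v n) = 1 := by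
    have h1 := hHerm.eigenvectorBasis.orthonormal.1 j
    rw [EuclideanSpace.norm_eq, Real.sqrt_eq_one] at h1
    rw [hv, ← h1]
    exact Finset.sum_congr rfl fun n _ => (Complex.normSq_eq_norm_sq _)
  have hq : ((2 * N : ℕ) : ℂ) * (star v ⬝ᵥ (T *ᵥ v)) = ∑ k ∈ Finset.range (2 * N),
      auxMu N ω c' k * ((Complex.normSq (auxX ω v k) : ℝ) : ℂ) := by
    simp only [aux_normSq ω h0 hω, dotProduct, mulVec, Finset.mul_sum]
    rw [Finset.sum_comm (s := Finset.range (2 * N))]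
    refine Finset.sum_congr rfl fun m _ => ?_
    rw [Finset.sum_comm (s := Finset.range (2 * N))]
    refine Finset.sum_congr rfl fun n _ => ?_
    calc _ = star (v m) * v n * (((2 * N : ℕ) : ℂ) * T m n) := by simp; ring
      _ = _ := by
        rw [hTe, Finset.mul_sum]
        refine Finset.sum_congr rfl fun k _ => ?_
        ring
  have hev : (2 * N : ℝ) * hHerm.eigenvalues j = ∑ k ∈ Finset.range (2 * N),
      (auxMu N ω c' k).re * Complex.normSq (auxX ω v k) := by
    have h2 := congrArg Complex.re hq
    rw [Complex.re_sum] at h2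
    simp only [Complex.re_mul_ofReal] at h2
    rw [← h2, hHerm.eigenvalues_eq, ← hv, ← Complex.ofReal_natCast, Complex.re_ofReal_mul]
    push_cast
    rfl
  rw [aux_split] at hev
  set a := ⨅ i : Fin N, (μ ⟨2 * i.1, by have := i.isLt; omega⟩).re with ha
  set b := ⨅ i : Fin N, (μ ⟨2 * i.1 + 1, by have := i.isLt; omega⟩).re with hb
  have hA : a * N ≤ ∑ i ∈ Finset.range N,
      (auxMu N ω c' (2 * i)).re * Complex.normSq (auxX ω v ((2 * i : ℕ) : ℤ)) := by
    have hp := aux_parseval hN ω hprim hω v 0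
    rw [hnorm, mul_one] at hp
    rw [← hp, Finset.mul_sum]
    refine Finset.sum_le_sum fun i hi => ?_
    rw [Finset.mem_range] at hi
    push_cast
    rw [add_zero]
    refine mul_le_mul_of_nonneg_right ?_ (Complex.normSq_nonneg _)
    have := ciInf_le (Set.finite_range
      (fun i : Fin N => (μ ⟨2 * i.1, by have := i.isLt; omega⟩).re)).bddBelow ⟨i, hi⟩
    exact this.trans_eq (by rw [hμ'])
  have hB : b * N ≤ ∑ i ∈ Finset.range N,
      (auxMu N ω c' (2 * i + 1)).re * Complex.normSq (auxX ω v ((2 * i + 1 : ℕ) : ℤ)) := by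
    have hp := aux_parseval hN ω hprim hω v 1
    rw [hnorm, mul_one] at hp
    rw [← hp, Finset.mul_sum]
    refine Finset.sum_le_sum fun i hi => ?_
    rw [Finset.mem_range] at hi
    push_cast
    refine mul_le_mul_of_nonneg_right ?_ (Complex.normSq_nonneg _)
    have := ciInf_le (Set.finite_range
      (fun i : Fin N => (μ ⟨2 * i.1 + 1, by have := i.isLt; omega⟩).re)).bddBelow ⟨i, hi⟩
    exact this.trans_eq (by rw [hμ'])
  have hNpos : (0 : ℝ) < N := by exact_mod_cast hN
  have : (N : ℝ) * ((1 / 2) * (a + b)) ≤ N * hHerm.eigenvalues j := by linarith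
  exact le_of_mul_le_mul_left this hNpos
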